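/- Fix integers k and D with D ≥ 1 and k > 2D, and set n = ⌈log(k/D)⌉ (log denoting the base-2 logarithm). There exists a positive constant C such that for every integer N ≥ 1, r_{k,D}(N)/N ≥ C · (log N)^{1/(2n)} / 2^{n · 2^{(n−1)/2} · D^{(n−1)/n} · (log N)^{1/n}}. -/

import Mathlib

/-- `A` contains a `k`-term `D`-progression: there is a nonconstant real polynomial `Q`
of degree at most `D` such that `Q 1, Q 2, …, Q k` all lie in `A`. -/
def HasProgression (A : Finset ℕ) (k D : ℕ) : Prop :=
  ∃ Q : Polynomial ℝ, 0 < Q.natDegree ∧ Q.natDegree ≤ D ∧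
    ∀ j ∈ Finset.Icc 1 k, ∃ m ∈ A, (m : ℝ) = Q.eval (j : ℝ)

/-- `rkD k D N` is the maximum size of a subset of `[1,N] ∩ ℤ` containing no
`k`-term `D`-progression. -/
noncomputable def rkD (k D N : ℕ) : ℕ :=
  sSup {m | ∃ A : Finset ℕ, A ⊆ Finset.Icc 1 N ∧ ¬ HasProgression A k D ∧ A.card = m}

/-- iterated difference -/
def dd {G : Type*} [AddCommGroup G] : ℕ → (ℕ → G) → ℕ → G
  | 0, f, y => f y
  | n + 1, f, y => dd n f (y + 1) - dd n f y

theorem dd_congr {G : Type*} [AddCommGroup G] (n : ℕ) (f g : ℕ → G) (y : ℕ)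
    (h : ∀ j, y ≤ j → j ≤ y + n → f j = g j) : dd n f y = dd n g y := by
  induction n generalizing y with
  | zero => exact h y le_rfl le_rfl
  | succ n ih =>
    simp only [dd]
    rw [ih (y + 1) (fun j h1 h2 => h j (by omega) (by omega)),
      ih y (fun j h1 h2 => h j (by omega) (by omega))]

theorem dd_map {G G' : Type*} [AddCommGroup G] [AddCommGroup G'] (φ : G →+ G') (n : ℕ)
    (f : ℕ → G) (y : ℕ) : dd n (fun j => φ (f j)) y = φ (dd n f y) := by
  induction n generalizing y with
  | zero => rfl
  | succ n ih => simp only [dd, ih, map_sub]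

theorem dd_add {G : Type*} [AddCommGroup G] (n : ℕ) (f g : ℕ → G) (y : ℕ) :
    dd n (fun j => f j + g j) y = dd n f y + dd n g y := by
  induction n generalizing y with
  | zero => rfl
  | succ n ih => simp only [dd, ih]; abel

theorem dd_const {G : Type*} [AddCommGroup G] (n : ℕ) (hn : 1 ≤ n) (c : G) (y : ℕ) :
    dd n (fun _ => c) y = 0 := by
  induction n generalizing y with
  | zero => omega
  | succ n ih =>
    rcases Nat.eq_zero_or_pos n with rfl | h
    · simp [dd]
    · simp only [dd, ih h, sub_zero]

theorem dd_bound (n : ℕ) (f : ℕ → ℤ) (y : ℕ) (B : ℤ)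
    (h : ∀ j, y ≤ j → j ≤ y + (n + 1) → 0 ≤ f j ∧ f j ≤ B) : |dd (n + 1) f y| ≤ 2 ^ n * B := by
  induction n generalizing y with
  | zero =>
    have h1 := h y (by omega) (by omega)
    have h2 := h (y + 1) (by omega) (by omega)
    simp only [dd]; rw [abs_le]; constructor <;> simp <;> linarith
  | succ n ih =>
    have h1 := ih y (fun j h1 h2 => h j (by omega) (by omega))
    have h2 := ih (y + 1) (fun j h1 h2 => h j (by omega) (by omega))
    have : dd (n + 1 + 1) f y = dd (n + 1) f (y + 1) - dd (n + 1) f y := rfl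
    rw [this]
    calc _ ≤ |dd (n + 1) f (y + 1)| + |dd (n + 1) f y| := abs_sub _ _
      _ ≤ _ := by rw [pow_succ]; linarith

theorem dd_poly (P : Polynomial ℝ) (n y : ℕ) :
    dd n (fun j => P.eval (j : ℝ)) y = ((fwdDiff (1 : ℝ))^[n] (fun z => P.eval z)) (y : ℝ) := by
  induction n generalizing y with
  | zero => rfl
  | succ n ih =>
    simp only [dd, ih, Function.iterate_succ', Function.comp, fwdDiff]
    push_cast; rfl

theorem dd_poly_zero (P : Polynomial ℝ) (n y : ℕ) (h : P.natDegree < n) :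
    dd n (fun j => P.eval (j : ℝ)) y = 0 := by
  rw [dd_poly, Polynomial.fwdDiff_iter_eq_zero_of_degree_lt h]; rfl

theorem dd_poly_top (P : Polynomial ℝ) (n y : ℕ) (h : P.natDegree ≤ n) :
    dd n (fun j => P.eval (j : ℝ)) y = P.coeff n * (n.factorial : ℝ) := by
  rcases h.lt_or_eq with h | h
  · rw [dd_poly_zero P n y h, Polynomial.coeff_eq_zero_of_natDegree_lt h, zero_mul]
  · subst h
    rw [dd_poly, Polynomial.fwdDiff_iter_degree_eq_factorial]
    simp

theorem dd_last {G : Type*} [AddCommGroup G] (n : ℕ) (f g : ℕ → G) (y : ℕ)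
    (h : ∀ j, y ≤ j → j < y + n → f j = g j) (hd : dd n f y = dd n g y) :
    f (y + n) = g (y + n) := by
  induction n generalizing y with
  | zero => exact hd
  | succ n ih =>
    simp only [dd] at hd
    rw [dd_congr n f g y (fun j h1 h2 => h j h1 (by omega))] at hd
    have := ih (y + 1) (fun j h1 h2 => h j (by omega) (by omega)) (sub_left_injective hd)
    rwa [show y + 1 + n = y + (n + 1) by ring] at this

/-- sequence with vanishing differences is polynomial -/
theorem exists_poly (k e : ℕ) (f : ℕ → ℝ)
    (h : ∀ y, 1 ≤ y → y + (e + 1) ≤ k → dd (e + 1) f y = 0) :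
    ∃ P : Polynomial ℝ, P.natDegree ≤ e ∧ ∀ j, 1 ≤ j → j ≤ k → f j = P.eval (j : ℝ) := by
  have inj : Set.InjOn (fun j : ℕ => (j : ℝ)) (Finset.Icc 1 (e + 1) : Finset ℕ) :=
    Nat.cast_injective.injOn
  let P := Lagrange.interpolate (Finset.Icc 1 (e + 1)) (fun j : ℕ => (j : ℝ)) f
  have hP : P.natDegree ≤ e := by
    have := Lagrange.degree_interpolate_le f inj
    simp only [Nat.card_Icc] at this
    exact Polynomial.natDegree_le_iff_degree_le.2 this
  refine ⟨P, hP, ?_⟩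
  intro j
  induction j using Nat.strong_induction_on with
  | _ j ih =>
    intro h1 h2
    by_cases hj : j ≤ e + 1
    · exact (Lagrange.eval_interpolate_at_node f inj (Finset.mem_Icc.2 ⟨h1, hj⟩)).symm
    · obtain ⟨y, rfl⟩ : ∃ y, j = y + (e + 1) := ⟨j - (e + 1), by omega⟩
      refine dd_last (e + 1) f (fun j => P.eval (j : ℝ)) y
        (fun i hi1 hi2 => ih i hi2 (by omega) (by omega)) ?_
      rw [h y (by omega) h2, dd_poly_zero P _ _ (by omega)]

theorem dd_zmod (p : ℕ) (n y : ℕ) (hn : 1 ≤ n) (x m : ℕ → ℤ) (α θ : ZMod p)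
    (h : ∀ j, y ≤ j → j ≤ y + n → ((x j : ℤ) : ZMod p) = α + θ * (m j : ZMod p)) :
    ((dd n x y : ℤ) : ZMod p) = θ * ((dd n m y : ℤ) : ZMod p) := by
  have h1 := dd_map (Int.castAddHom (ZMod p)) n x y
  have h2 := dd_map ((AddMonoidHom.mulLeft θ).comp (Int.castAddHom (ZMod p))) n m y
  simp only [Int.coe_castAddHom, AddMonoidHom.coe_comp, Function.comp, AddMonoidHom.coe_mulLeft]
    at h1 h2
  rw [← h1, ← h2, dd_congr n _ _ y h, dd_add, dd_const n hn, zero_add]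

theorem core (p D e k d : ℕ) (H w M t : ℤ) (m a : ℕ → ℤ) (x : ℕ → Fin d → ℤ)
    (α θ : Fin d → ZMod p) (he : 1 ≤ e) (heD : e ≤ D) (hk : 2 * D < k)
    (hH : 1 ≤ H) (hw : 1 ≤ w)
    (hm : ∀ y, 1 ≤ y → y + (e + 1) ≤ k → dd (e + 1) m y = 0)
    (hx : ∀ j, 1 ≤ j → j ≤ k → ∀ i, 0 ≤ x j i ∧ x j i ≤ H - 1 ∧
      ((x j i : ℤ) : ZMod p) = α i + θ i * (m j : ZMod p))
    (hp : 2 ^ D * (H - 1) < p) (hM : 2 ^ (2 * D) ≤ M)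
    (hs : ∀ j, 1 ≤ j → j ≤ k → (∑ i, x j i ^ 2) / w = M * a j + t)
    (ha : ∀ P : Polynomial ℝ, P.natDegree ≤ 2 * D →
      (∀ j, 1 ≤ j → j ≤ k → (a j : ℝ) = P.eval (j : ℝ)) → P.natDegree = 0) :
    ∃ y : Fin d → ℤ, ∑ i, y i ^ 2 ≤ 2 ^ (2 * D) * w ∧
      ∀ i, (y i : ZMod p) = θ i * ((dd e m 1 : ℤ) : ZMod p) := by
  refine ⟨fun i => dd e (fun j => x j i) 1, ?_, fun i =>
    dd_zmod p e 1 he (fun j => x j i) m (α i) (θ i)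
      (fun j h1 h2 => (hx j h1 (by omega) i).2.2)⟩
  -- x is polynomial
  have pD : (2 : ℤ) ^ e ≤ 2 ^ D := pow_le_pow_right₀ (by norm_num) heD
  have hxz : ∀ i y, 1 ≤ y → y + (e + 1) ≤ k → dd (e + 1) (fun j => x j i) y = 0 := by
    intro i y h1 h2
    have hb := dd_bound e (fun j => x j i) y (H - 1) (fun j h3 h4 =>
      ⟨(hx j (by omega) (by omega) i).1, (hx j (by omega) (by omega) i).2.1⟩)
    have hz := dd_zmod p (e + 1) y (by omega) (fun j => x j i) m (α i) (θ i)
      (fun j h3 h4 => (hx j (by omega) (by omega) i).2.2)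
    rw [hm y h1 h2, Int.cast_zero, mul_zero, ZMod.intCast_zmod_eq_zero_iff_dvd] at hz
    refine Int.eq_zero_of_abs_lt_dvd hz (lt_of_le_of_lt hb (lt_of_le_of_lt ?_ hp))
    exact mul_le_mul_of_nonneg_right pD (by omega)
  have hX : ∀ i, ∃ P : Polynomial ℝ, P.natDegree ≤ e ∧
      ∀ j, 1 ≤ j → j ≤ k → (x j i : ℝ) = P.eval (j : ℝ) := by
    intro i
    refine exists_poly k e (fun j => (x j i : ℝ)) (fun y h1 h2 => ?_)
    have := dd_map (Int.castAddHom ℝ) (e + 1) (fun j => x j i) y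
    rw [hxz i y h1 h2] at this
    simpa using this
  choose X hX1 hX2 using hX
  let S : Polynomial ℝ := ∑ i, X i ^ 2
  have hS1 : S.natDegree ≤ 2 * e := by
    refine Polynomial.natDegree_sum_le_of_forall_le _ _ (fun i _ => ?_)
    refine Polynomial.natDegree_pow_le.trans ?_
    have := hX1 i
    omega
  have hS2 : ∀ j, 1 ≤ j → j ≤ k → ((∑ i, x j i ^ 2 : ℤ) : ℝ) = S.eval (j : ℝ) := by
    intro j h1 h2
    simp only [S, Polynomial.eval_finsetSum, Polynomial.eval_pow]
    push_cast
    exact Finset.sum_congr rfl (fun i _ => by rw [hX2 i j h1 h2])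
  have hS3 : S.coeff (2 * e) = ∑ i, (X i).coeff e ^ 2 := by
    simp only [S, Polynomial.finsetSum_coeff]
    refine Finset.sum_congr rfl (fun i _ => ?_)
    rw [Polynomial.coeff_pow_of_natDegree_le (hX1 i)]
  let s : ℕ → ℤ := fun j => ∑ i, x j i ^ 2
  let r : ℕ → ℤ := fun j => s j % w
  have hr : ∀ j, 0 ≤ r j ∧ r j ≤ w - 1 := fun j =>
    ⟨Int.emod_nonneg _ (by omega), by have := Int.emod_lt_of_pos (s j) (by omega : 0 < w); 
                                      simp only [r]; omega⟩
  have hsr : ∀ j, 1 ≤ j → j ≤ k → s j = (w * M * a j + w * t) + r j := by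
    intro j h1 h2
    have h3 := Int.mul_ediv_add_emod (s j) w
    have h4 : s j / w = M * a j + t := hs j h1 h2
    rw [h4] at h3
    simp only [r]; linarith
  have hds : ∀ n y, dd n (fun j => ((s j : ℤ) : ℝ)) y = ((dd n s y : ℤ) : ℝ) := fun n y =>
    dd_map (Int.castAddHom ℝ) n s y
  have hs0 : ∀ y, 1 ≤ y → y + (2 * e + 1) ≤ k → dd (2 * e + 1) s y = 0 := by
    intro y h1 h2
    have h3 := hds (2 * e + 1) y
    rw [dd_congr _ _ (fun j => S.eval (j : ℝ)) y (fun j h5 h6 => hS2 j (by omega) (by omega)),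
      dd_poly_zero _ _ _ (by omega)] at h3
    exact_mod_cast h3.symm
  have pD2 : (2 : ℤ) ^ (2 * e) ≤ 2 ^ (2 * D) := pow_le_pow_right₀ (by norm_num) (by omega)
  have haz : ∀ y, 1 ≤ y → y + (2 * e + 1) ≤ k → dd (2 * e + 1) a y = 0 := by
    intro y h1 h2
    have h3 := hs0 y h1 h2
    rw [dd_congr _ _ (fun j => (w * M * a j + w * t) + r j) y
      (fun j h5 h6 => hsr j (by omega) (by omega)), dd_add, dd_add, dd_const _ (by omega),
      add_zero] at h3
    have h4 := dd_map (AddMonoidHom.mulLeft (w * M)) (2 * e + 1) a y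
    simp only [AddMonoidHom.coe_mulLeft] at h4
    rw [h4] at h3
    have h5 := dd_bound (2 * e) r y (w - 1) (fun j _ _ => hr j)
    by_contra h6
    have h7 : 1 ≤ |dd (2 * e + 1) a y| := Int.one_le_abs h6
    have h8 : |w * M * dd (2 * e + 1) a y| = |dd (2 * e + 1) r y| := by
      rw [show w * M * dd (2 * e + 1) a y = - dd (2 * e + 1) r y by linarith, abs_neg]
    have hMpos : 0 < M := lt_of_lt_of_le (by positivity) hM
    rw [abs_mul, abs_of_pos (by positivity)] at h8
    have h9 : w * M ≤ w * M * |dd (2 * e + 1) a y| := le_mul_of_one_le_right (by positivity) h7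
    have h10 : (2 : ℤ) ^ (2 * e) * (w - 1) ≤ M * (w - 1) :=
      mul_le_mul_of_nonneg_right (by linarith) (by omega)
    nlinarith
  obtain ⟨P, hP1, hP2⟩ := exists_poly k (2 * e) (fun j => (a j : ℝ)) (fun y h1 h2 => by
    have := dd_map (Int.castAddHom ℝ) (2 * e + 1) a y
    rw [haz y h1 h2] at this
    simpa using this)
  have hP0 := ha P (by omega) hP2
  have hac : ∀ j, 1 ≤ j → j ≤ k → a j = a 1 := by
    intro j h1 h2
    have h3 := hP2 j h1 h2
    have h4 := hP2 1 le_rfl (by omega)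
    rw [Polynomial.eq_C_of_natDegree_eq_zero hP0, Polynomial.eval_C] at h3 h4
    exact_mod_cast h3.trans h4.symm
  have htop : dd (2 * e) s 1 ≤ 2 ^ (2 * D) * w := by
    rw [dd_congr _ _ (fun j => (w * M * a 1 + w * t) + r j) 1
      (fun j h5 h6 => by rw [hsr j (by omega) (by omega), hac j (by omega) (by omega)]),
      dd_add, dd_const _ (by omega), zero_add]
    obtain ⟨q, hq⟩ : ∃ q, 2 * e = q + 1 := ⟨2 * e - 1, by omega⟩
    rw [hq]
    have h5 := dd_bound q r 1 (w - 1) (fun j _ _ => hr j)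
    have h6 : (2 : ℤ) ^ q ≤ 2 ^ (2 * D) := pow_le_pow_right₀ (by norm_num) (by omega)
    have h7 := (abs_le.1 h5).2
    have h8 : (0 : ℤ) < 2 ^ (2 * D) := by positivity
    nlinarith
  have e1 : ((dd (2 * e) s 1 : ℤ) : ℝ) = (∑ i, (X i).coeff e ^ 2) * ((2 * e).factorial : ℝ) := by
    rw [← hds, dd_congr _ _ (fun j => S.eval (j : ℝ)) 1
      (fun j h5 h6 => hS2 j (by omega) (by omega)), dd_poly_top _ _ _ hS1, hS3]
  have e2 : ∀ i, ((dd e (fun j => x j i) 1 : ℤ) : ℝ) = (X i).coeff e * (e.factorial : ℝ) := by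
    intro i
    rw [← dd_poly_top (X i) e 1 (hX1 i), dd_congr e _ (fun j => (x j i : ℝ)) 1
      (fun j h5 h6 => (hX2 i j (by omega) (by omega)).symm)]
    exact (dd_map (Int.castAddHom ℝ) e (fun j => x j i) 1).symm
  have fin : ((∑ i, dd e (fun j => x j i) 1 ^ 2 : ℤ) : ℝ) ≤ ((dd (2 * e) s 1 : ℤ) : ℝ) := by
    rw [e1]
    push_cast
    rw [Finset.sum_mul]
    refine Finset.sum_le_sum (fun i _ => ?_)
    rw [e2, mul_pow]
    refine mul_le_mul_of_nonneg_left ?_ (sq_nonneg _)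
    have := Nat.le_of_dvd (Nat.factorial_pos _) (Nat.factorial_mul_factorial_dvd_factorial_add e e)
    rw [two_mul, sq]; exact_mod_cast this
  exact le_trans (by exact_mod_cast fin) htop

theorem sum_natAbs_le (Y : ℕ) (g : ℕ → ℝ) (hg : ∀ j, 0 ≤ g j) :
    ∑ z ∈ Finset.Icc (-(Y : ℤ)) Y, g z.natAbs ≤ 2 * ∑ j ∈ Finset.range (Y + 1), g j := by
  rw [← Finset.sum_fiberwise_of_maps_to (s := Finset.Icc (-(Y : ℤ)) Y)
    (t := Finset.range (Y + 1)) (g := Int.natAbs)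
    (fun z hz => by rw [Finset.mem_Icc] at hz; rw [Finset.mem_range]; omega), Finset.mul_sum]
  refine Finset.sum_le_sum (fun j _ => ?_)
  have hsub : (Finset.Icc (-(Y : ℤ)) Y).filter (fun z => z.natAbs = j) ⊆ {(j : ℤ), -(j : ℤ)} := by
    intro z hz
    simp only [Finset.mem_filter, Finset.mem_insert, Finset.mem_singleton] at hz ⊢
    omega
  have hc := (Finset.card_le_card hsub).trans Finset.card_le_two
  rw [Finset.sum_congr rfl (g := fun _ => g j) (fun z hz => by rw [(Finset.mem_filter.1 hz).2]),
    Finset.sum_const, nsmul_eq_mul]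
  exact mul_le_mul_of_nonneg_right (by exact_mod_cast hc) (hg j)

theorem ball_card (d ρ : ℕ) (hρ : 1 ≤ ρ) (F : Finset (Fin d → ℤ))
    (hF : ∀ y ∈ F, ∑ i, y i ^ 2 ≤ (d : ℤ) * (ρ : ℤ) ^ 2) :
    (F.card : ℝ) ≤ (12 * (ρ : ℝ)) ^ d := by
  have hρ' : (1 : ℝ) ≤ ρ := by exact_mod_cast hρ
  set q : ℝ := ρ / (ρ + 1) with hq
  have hq0 : 0 < q := by positivity
  have hq1 : q < 1 := by rw [hq, div_lt_one (by positivity)]; linarith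
  have hqi : q⁻¹ = 1 + 1 / ρ := by rw [hq]; field_simp
  have hl1 : ∀ y ∈ F, ∑ i, (y i).natAbs ≤ d * ρ := by
    intro y hy
    have h1 := hF y hy
    have h2 := sq_sum_le_card_mul_sum_sq (s := Finset.univ) (f := fun i => |y i|)
    simp only [sq_abs, Finset.card_univ, Fintype.card_fin] at h2
    have h3 : (∑ i, |y i|) ^ 2 ≤ ((d : ℤ) * ρ) ^ 2 := by
      calc _ ≤ _ := h2
        _ ≤ (d : ℤ) * (d * ρ ^ 2) := mul_le_mul_of_nonneg_left h1 (by positivity)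
        _ = _ := by ring
    have h4 := abs_le_of_sq_le_sq' h3 (by positivity)
    have h5 : ((∑ i, (y i).natAbs : ℕ) : ℤ) = ∑ i, |y i| := by
      push_cast; rfl
    have h6 := h4.2
    rw [← h5] at h6
    exact_mod_cast h6
  have hsub : F ⊆ Fintype.piFinset (fun _ : Fin d => Finset.Icc (-((d * ρ : ℕ) : ℤ)) ((d * ρ : ℕ) : ℤ)) := by
    intro y hy
    rw [Fintype.mem_piFinset]
    intro i
    have h1 := hl1 y hy
    have h2 : (y i).natAbs ≤ ∑ i, (y i).natAbs :=
      Finset.single_le_sum (f := fun i => (y i).natAbs) (fun _ _ => Nat.zero_le _) (Finset.mem_univ i)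
    rw [Finset.mem_Icc]
    omega
  have hw : ∀ y ∈ F, (1 : ℝ) ≤ q⁻¹ ^ (d * ρ) * ∏ i, q ^ (y i).natAbs := by
    intro y hy
    rw [Finset.prod_pow_eq_pow_sum, inv_pow, inv_mul_eq_div, one_le_div (by positivity)]
    exact pow_le_pow_of_le_one hq0.le hq1.le (hl1 y hy)
  have hgeo : ∑ z ∈ Finset.Icc (-((d * ρ : ℕ) : ℤ)) ((d * ρ : ℕ) : ℤ), q ^ z.natAbs ≤ 4 * ρ := by
    refine (sum_natAbs_le (d * ρ) (fun j => q ^ j) (fun j => by positivity)).trans ?_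
    have h1 : ∑ j ∈ Finset.range (d * ρ + 1), q ^ j ≤ (1 - q)⁻¹ := by
      rw [← tsum_geometric_of_lt_one hq0.le hq1]
      exact (summable_geometric_of_lt_one hq0.le hq1).sum_le_tsum _ (fun j _ => by positivity)
    have h2 : (1 - q)⁻¹ = ρ + 1 := by rw [hq]; field_simp; ring
    rw [h2] at h1
    linarith
  have he : q⁻¹ ^ ρ ≤ 3 := by
    have h1 : q⁻¹ ≤ Real.exp (1 / ρ) := by
      rw [hqi]; linarith [Real.add_one_le_exp (1 / (ρ : ℝ))]
    have h2 : Real.exp (1 / ρ) ^ ρ = Real.exp 1 := by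
      rw [← Real.exp_nat_mul]; congr 1; field_simp
    calc _ ≤ Real.exp (1 / ρ) ^ ρ := pow_le_pow_left₀ (by positivity) h1 _
      _ ≤ 3 := by rw [h2]; linarith [Real.exp_one_lt_d9]
  calc (F.card : ℝ) = ∑ y ∈ F, (1 : ℝ) := by simp
    _ ≤ ∑ y ∈ F, q⁻¹ ^ (d * ρ) * ∏ i, q ^ (y i).natAbs := Finset.sum_le_sum hw
    _ ≤ ∑ y ∈ Fintype.piFinset (fun _ : Fin d => Finset.Icc (-((d * ρ : ℕ) : ℤ)) ((d * ρ : ℕ) : ℤ)),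
          q⁻¹ ^ (d * ρ) * ∏ i, q ^ (y i).natAbs :=
        Finset.sum_le_sum_of_subset_of_nonneg hsub (fun _ _ _ => by positivity)
    _ = q⁻¹ ^ (d * ρ) * (∑ z ∈ Finset.Icc (-((d * ρ : ℕ) : ℤ)) ((d * ρ : ℕ) : ℤ), q ^ z.natAbs) ^ d := by
        rw [← Finset.mul_sum, ← Finset.prod_univ_sum
          (t := fun _ : Fin d => Finset.Icc (-((d * ρ : ℕ) : ℤ)) ((d * ρ : ℕ) : ℤ))
          (f := fun _ z => q ^ z.natAbs)]
        simp
    _ ≤ 3 ^ d * (4 * ρ) ^ d := by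
        have hpos : 0 ≤ ∑ z ∈ Finset.Icc (-((d * ρ : ℕ) : ℤ)) ((d * ρ : ℕ) : ℤ), q ^ z.natAbs :=
          Finset.sum_nonneg (fun _ _ => by positivity)
        refine mul_le_mul ?_ (pow_le_pow_left₀ hpos hgeo d) (by positivity) (by positivity)
        rw [mul_comm d ρ, pow_mul]
        exact pow_le_pow_left₀ (by positivity) he d
    _ = _ := by rw [← mul_pow]; ring

theorem exists_theta (p d ρ B : ℕ) [Fact p.Prime] (hρ : 1 ≤ ρ) (hB : B < p)
    (h : (2 * (B : ℝ)) * (12 * (ρ : ℝ)) ^ d < (p : ℝ) ^ d) :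
    ∃ θ : Fin d → ZMod p, ∀ b : ℤ, b ≠ 0 → |b| ≤ B → ∀ y : Fin d → ℤ,
      ∑ i, y i ^ 2 ≤ (d : ℤ) * (ρ : ℤ) ^ 2 → ¬ ∀ i, (y i : ZMod p) = θ i * (b : ZMod p) := by
  classical
  by_contra hcon
  push Not at hcon
  choose b hb0 hb y hy hyθ using hcon
  let F : Finset (Fin d → ℤ) := Finset.univ.image y
  have hF : (F.card : ℝ) ≤ (12 * (ρ : ℝ)) ^ d := by
    refine ball_card d ρ hρ F (fun z hz => ?_)
    obtain ⟨θ, _, rfl⟩ := Finset.mem_image.1 hz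
    exact hy θ
  let Bs : Finset ℤ := (Finset.Icc (-(B : ℤ)) B).erase 0
  have hBs : Bs.card = 2 * B := by
    rw [Finset.card_erase_of_mem (by simp), Int.card_Icc]
    omega
  have hinj : Function.Injective (fun θ => (b θ, y θ)) := by
    intro θ θ' hh
    simp only [Prod.mk.injEq] at hh
    funext i
    have h1 := hyθ θ i
    have h2 := hyθ θ' i
    rw [← hh.1, ← hh.2, h1] at h2
    refine mul_right_cancel₀ ?_ h2
    intro h3
    rw [ZMod.intCast_zmod_eq_zero_iff_dvd] at h3
    refine hb0 θ (Int.eq_zero_of_abs_lt_dvd h3 (lt_of_le_of_lt (hb θ) (by exact_mod_cast hB)))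
  have hcard : (Finset.univ : Finset (Fin d → ZMod p)).card ≤ (Bs ×ˢ F).card := by
    refine Finset.card_le_card_of_injOn (fun θ => (b θ, y θ)) (fun θ _ => ?_) hinj.injOn
    simp only [Finset.coe_product, Set.mem_prod, Finset.mem_coe]
    refine ⟨Finset.mem_erase.2 ⟨hb0 θ, ?_⟩, Finset.mem_image_of_mem y (Finset.mem_univ θ)⟩
    rw [Finset.mem_Icc]
    exact abs_le.1 (hb θ)
  rw [Finset.card_univ, Fintype.card_fun, ZMod.card, Fintype.card_fin, Finset.card_product,
    hBs] at hcard
  have hcard' : (p : ℝ) ^ d ≤ 2 * (B : ℝ) * F.card := by exact_mod_cast hcard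
  have : 2 * (B : ℝ) * F.card ≤ 2 * (B : ℝ) * (12 * (ρ : ℝ)) ^ d :=
    mul_le_mul_of_nonneg_left hF (by positivity)
  linarith

open Classical in
theorem exists_alpha (p d N H : ℕ) [Fact p.Prime] (hH : H ≤ p) (θ : Fin d → ZMod p)
    (S : Finset (Fin d → Fin H)) :
    ∃ α : Fin d → ZMod p, N * S.card ≤
      ((Finset.Icc 1 N).filter (fun m : ℕ => ∃ x ∈ S, ∀ i,
        (((x i : Fin H) : ℕ) : ZMod p) = α i + θ i * (m : ZMod p))).card * p ^ d := by
  let R : (Fin d → ZMod p) → ℕ → Prop := fun α m => ∃ x ∈ S, ∀ i,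
        (((x i : Fin H) : ℕ) : ZMod p) = α i + θ i * (m : ZMod p)
  have h1 := Finset.sum_card_bipartiteAbove_eq_sum_card_bipartiteBelow (s := Finset.univ)
    (t := Finset.Icc 1 N) R
  have h2 : ∀ m ∈ Finset.Icc 1 N, S.card ≤ (Finset.bipartiteBelow R Finset.univ m).card := by
    intro m _
    refine Finset.card_le_card_of_injOn
      (fun x i => (((x i : Fin H) : ℕ) : ZMod p) - θ i * (m : ZMod p)) (fun x hx => ?_) ?_
    · simp only [Finset.bipartiteBelow, Finset.coe_filter, Set.mem_ofPred_eq, Finset.mem_univ,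
        true_and]
      exact ⟨x, hx, fun i => by ring⟩
    · intro x _ x' _ hxx
      funext i
      have := congrFun hxx i
      simp only [sub_left_inj] at this
      rw [ZMod.natCast_eq_natCast_iff'] at this
      rw [Nat.mod_eq_of_lt ((x i).2.trans_le hH), Nat.mod_eq_of_lt ((x' i).2.trans_le hH)] at this
      exact Fin.ext this
  have h3 := Finset.sum_le_sum h2
  rw [← h1] at h3
  simp only [Finset.sum_const, Nat.card_Icc, Nat.add_sub_cancel, smul_eq_mul] at h3
  by_contra hcon
  push Not at hcon
  have h4 : ∑ α : Fin d → ZMod p, (Finset.bipartiteAbove R (Finset.Icc 1 N) α).card * p ^ d <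
      ∑ α : Fin d → ZMod p, N * S.card :=
    Finset.sum_lt_sum_of_nonempty Finset.univ_nonempty (fun α _ => hcon α)
  rw [← Finset.sum_mul, Finset.sum_const, Finset.card_univ, Fintype.card_fun, ZMod.card,
    Fintype.card_fin, smul_eq_mul, mul_comm (p ^ d)] at h4
  exact absurd (Nat.mul_le_mul_right (p ^ d) h3) (not_le.2 h4)

theorem moments (H : ℕ) (g : Fin H → ℝ) (hg : ∑ z, g z = 0) (V : ℝ) (hV : ∀ z, g z ^ 2 ≤ V)
    (d : ℕ) : ∑ x : Fin d → Fin H, ∑ i, g (x i) = 0 ∧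
      ∑ x : Fin d → Fin H, (∑ i, g (x i)) ^ 2 ≤ d * V * (H : ℝ) ^ d := by
  induction d with
  | zero => simp
  | succ d ih =>
    have key : ∀ f : (Fin (d + 1) → Fin H) → ℝ, ∑ x, f x =
        ∑ z : Fin H, ∑ x : Fin d → Fin H, f (Fin.cons z x) := by
      intro f
      rw [← Fintype.sum_prod_type']
      exact (Fintype.sum_equiv (Fin.consEquiv (fun _ => Fin H)) _ _ (fun _ => rfl)).symm
    have hVs : ∑ z, g z ^ 2 ≤ H * V := by
      refine (Finset.sum_le_sum (fun z _ => hV z)).trans ?_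
      simp
    constructor
    · rw [key]
      simp only [Fin.sum_univ_succ, Fin.cons_zero, Fin.cons_succ, Finset.sum_add_distrib, ih.1]
      simp [← Finset.mul_sum, hg]
    · rw [key]
      simp only [Fin.sum_univ_succ, Fin.cons_zero, Fin.cons_succ]
      have : ∀ z : Fin H, ∑ x : Fin d → Fin H, (g z + ∑ i, g (x i)) ^ 2 =
          (H : ℝ) ^ d * g z ^ 2 + ∑ x : Fin d → Fin H, (∑ i, g (x i)) ^ 2 := by
        intro z
        simp only [add_sq, Finset.sum_add_distrib, ← Finset.mul_sum, ih.1]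
        simp
      simp only [this, Finset.sum_add_distrib, ← Finset.mul_sum]
      simp only [Finset.sum_const, Finset.card_univ, Fintype.card_fin, nsmul_eq_mul]
      have h1 : (H : ℝ) ^ d * ∑ z, g z ^ 2 ≤ (H : ℝ) ^ d * (H * V) :=
        mul_le_mul_of_nonneg_left hVs (by positivity)
      have h2 : (H : ℝ) * ∑ x : Fin d → Fin H, (∑ i, g (x i)) ^ 2 ≤ H * (d * V * (H : ℝ) ^ d) :=
        mul_le_mul_of_nonneg_left ih.2 (by positivity)
      push_cast
      rw [pow_succ]
      linarith

open Classical in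
theorem window (H d : ℕ) (hH : 1 ≤ H) (hd : 1 ≤ d) : ∃ c : ℝ, 3 / 4 * (H : ℝ) ^ d ≤
    ((Finset.univ.filter (fun x : Fin d → Fin H =>
      |((∑ i, ((x i : ℕ) : ℤ) ^ 2 : ℤ) : ℝ) - c| ≤ 2 * H ^ 2 * √d)).card : ℝ) := by
  have hH' : (1 : ℝ) ≤ H := by exact_mod_cast hH
  have hd' : (1 : ℝ) ≤ d := by exact_mod_cast hd
  set μ : ℝ := (∑ z : Fin H, ((z : ℕ) : ℝ) ^ 2) / H with hμ
  have hz : ∀ z : Fin H, 0 ≤ ((z : ℕ) : ℝ) ^ 2 ∧ ((z : ℕ) : ℝ) ^ 2 ≤ (H : ℝ) ^ 2 := fun z =>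
    ⟨by positivity, pow_le_pow_left₀ (by positivity) (by exact_mod_cast z.2.le) 2⟩
  have hμ0 : 0 ≤ μ := by positivity
  have hμ1 : μ ≤ (H : ℝ) ^ 2 := by
    rw [hμ, div_le_iff₀ (by positivity)]
    refine (Finset.sum_le_sum (fun z _ => (hz z).2)).trans ?_
    simp [mul_comm]
  let g : Fin H → ℝ := fun z => ((z : ℕ) : ℝ) ^ 2 - μ
  have hg : ∑ z, g z = 0 := by
    simp only [g, Finset.sum_sub_distrib, Finset.sum_const, Finset.card_univ, Fintype.card_fin,
      nsmul_eq_mul, hμ]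
    field_simp; ring
  have hV : ∀ z, g z ^ 2 ≤ (H : ℝ) ^ 4 := by
    intro z
    have := hz z
    have h1 : |g z| ≤ (H : ℝ) ^ 2 := by
      simp only [g]; rw [abs_le]; constructor <;> linarith
    calc g z ^ 2 = |g z| ^ 2 := (sq_abs _).symm
      _ ≤ ((H : ℝ) ^ 2) ^ 2 := pow_le_pow_left₀ (abs_nonneg _) h1 2
      _ = _ := by ring
  have hm := (moments H g hg _ hV d).2
  refine ⟨d * μ, ?_⟩
  have hsum : ∀ x : Fin d → Fin H,
      ((∑ i, ((x i : ℕ) : ℤ) ^ 2 : ℤ) : ℝ) - d * μ = ∑ i, g (x i) := by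
    intro x
    simp [g, Finset.sum_sub_distrib]
  simp only [hsum]
  set W := Finset.univ.filter (fun x : Fin d → Fin H => |∑ i, g (x i)| ≤ 2 * H ^ 2 * √d)
  have hW : W.card + (Finset.univ.filter (fun x : Fin d → Fin H =>
      ¬ |∑ i, g (x i)| ≤ 2 * H ^ 2 * √d)).card = H ^ d := by
    have := Finset.card_filter_add_card_filter_not (s := (Finset.univ : Finset (Fin d → Fin H)))
      (fun x => |∑ i, g (x i)| ≤ 2 * H ^ 2 * √d)
    rw [this]; simp
  set U := (Finset.univ.filter (fun x : Fin d → Fin H =>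
      ¬ |∑ i, g (x i)| ≤ 2 * H ^ 2 * √d)) with hU
  have h5 : (U.card : ℝ) * (4 * H ^ 4 * d) ≤ d * H ^ 4 * (H : ℝ) ^ d := by
    refine le_trans ?_ hm
    calc (U.card : ℝ) * (4 * H ^ 4 * d) = ∑ x ∈ U, (4 * (H : ℝ) ^ 4 * d) := by simp
      _ ≤ ∑ x ∈ U, (∑ i, g (x i)) ^ 2 := by
        refine Finset.sum_le_sum (fun x hx => ?_)
        have h6 := (Finset.mem_filter.1 hx).2
        push Not at h6
        have h7 := pow_le_pow_left₀ (by positivity) h6.le 2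
        rw [sq_abs, mul_pow, Real.sq_sqrt (by positivity)] at h7
        linarith
      _ ≤ _ := Finset.sum_le_univ_sum_of_nonneg (fun x => sq_nonneg _)
  have h6 : (U.card : ℝ) * 4 ≤ (H : ℝ) ^ d := by
    have : 0 < (d : ℝ) * H ^ 4 := by positivity
    refine le_of_mul_le_mul_left ?_ this
    linarith
  have h7 : (W.card : ℝ) + U.card = (H : ℝ) ^ d := by exact_mod_cast hW
  linarith

open Classical in
theorem exists_shift {ι : Type*} (X : Finset ι) (u : ι → ℤ) (u0 : ℤ) (K M N0 : ℕ)
    (hK : 1 ≤ K) (hM : 1 ≤ M)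
    (hX : ∀ x ∈ X, u0 ≤ u x ∧ u x < u0 + K) (A : Finset ℕ) (hA : A ⊆ Finset.Icc 1 N0) :
    ∃ t : ℤ, A.card * X.card ≤
      (K + M * N0) * (X.filter (fun x => ∃ a ∈ A, u x = M * (a : ℤ) + t)).card := by
  let T : Finset ℤ := Finset.Ico (u0 - (M * N0 : ℕ)) (u0 + K)
  have hT : T.card = K + M * N0 := by
    simp only [T, Int.card_Ico]; omega
  let R : ι → ℤ → Prop := fun x t => ∃ a ∈ A, u x = M * (a : ℤ) + t
  have h1 := Finset.sum_card_bipartiteAbove_eq_sum_card_bipartiteBelow (s := X) (t := T) R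
  have h2 : ∀ x ∈ X, A.card ≤ (Finset.bipartiteAbove R T x).card := by
    intro x hx
    refine Finset.card_le_card_of_injOn (fun a => u x - M * (a : ℤ)) (fun a ha => ?_) ?_
    · have h3 := Finset.mem_Icc.1 (hA ha)
      have h4 := hX x hx
      have h5 : (M : ℤ) * a ≤ M * N0 := by exact_mod_cast Nat.mul_le_mul_left M h3.2
      have h6 : (0 : ℤ) ≤ M * a := by positivity
      simp only [Finset.bipartiteAbove, Finset.coe_filter, Set.mem_ofPred_eq, T, Finset.mem_Ico]
      refine ⟨⟨by push_cast; linarith, by linarith⟩, a, ha, by ring⟩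
    · intro a _ a' _ h
      have hM' : (M : ℤ) ≠ 0 := by exact_mod_cast (by omega : M ≠ 0)
      have h : u x - M * (a : ℤ) = u x - M * (a' : ℤ) := h
      have h3 : (M : ℤ) * a = M * a' := by linarith
      exact_mod_cast mul_left_cancel₀ hM' h3
  have h3 := Finset.sum_le_sum h2
  rw [h1, Finset.sum_const, smul_eq_mul] at h3
  by_contra hcon
  push Not at hcon
  have hTne : T.Nonempty := by rw [← Finset.card_pos, hT]; omega
  have h4 : ∑ t ∈ T, (K + M * N0) * (Finset.bipartiteBelow R X t).card <
      ∑ t ∈ T, A.card * X.card :=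
    Finset.sum_lt_sum_of_nonempty hTne (fun t _ => hcon t)
  rw [← Finset.mul_sum, Finset.sum_const, hT, smul_eq_mul] at h4
  have h5 := lt_of_mul_lt_mul_left' h4
  rw [mul_comm A.card] at h5
  exact absurd h3 (not_le.2 h5)

theorem rkD_bdd (k D N : ℕ) : BddAbove {m | ∃ A : Finset ℕ, A ⊆ Finset.Icc 1 N ∧
    ¬ HasProgression A k D ∧ A.card = m} := by
  refine ⟨N, ?_⟩
  rintro m ⟨A, hA, _, rfl⟩
  simpa using Finset.card_le_card hA

theorem le_rkD (k D N : ℕ) (A : Finset ℕ) (hA : A ⊆ Finset.Icc 1 N)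
    (h : ¬ HasProgression A k D) : A.card ≤ rkD k D N :=
  le_csSup (rkD_bdd k D N) ⟨A, hA, h, rfl⟩

theorem rkD_attained (k D N : ℕ) (hk : 1 ≤ k) : ∃ A : Finset ℕ, A ⊆ Finset.Icc 1 N ∧
    ¬ HasProgression A k D ∧ A.card = rkD k D N := by
  have hne : {m | ∃ A : Finset ℕ, A ⊆ Finset.Icc 1 N ∧
      ¬ HasProgression A k D ∧ A.card = m}.Nonempty := by
    refine ⟨0, ∅, by simp, ?_, by simp⟩
    rintro ⟨Q, _, _, h⟩
    obtain ⟨m, hm, _⟩ := h 1 (by simp [hk])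
    simp at hm
  exact Nat.sSup_mem hne (rkD_bdd k D N)

theorem one_le_rkD (k D N : ℕ) (hk : D < k) (hN : 1 ≤ N) : 1 ≤ rkD k D N := by
  have := le_rkD k D N {1} (by simp [hN]) ?_
  · simpa using this
  rintro ⟨Q, h0, hD, h⟩
  have hQ : Q = Polynomial.C 1 := by
    refine Polynomial.eq_of_natDegree_lt_card_of_eval_eq' Q (Polynomial.C 1)
      ((Finset.Icc 1 k).image (fun j : ℕ => (j : ℝ))) ?_ ?_
    · intro x hx
      obtain ⟨j, hj, rfl⟩ := Finset.mem_image.1 hx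
      obtain ⟨m, hm, h2⟩ := h j hj
      rw [Finset.mem_singleton.1 hm] at h2
      rw [← h2]; simp
    · rw [Finset.card_image_of_injective _ Nat.cast_injective]
      simp; omega
  rw [hQ] at h0
  simp at h0

open Classical in
theorem step_nat (p k D d N N0 H ρ : ℕ) [Fact p.Prime] (hd : 1 ≤ d) (hk : 2 * D < k)
    (hρ : 1 ≤ ρ) (hH : 1 ≤ H) (hHp : 2 ^ D * (H - 1) < p) (hNp : 2 ^ D * N < p)
    (hθ : (2 * ((2 ^ D * N : ℕ) : ℝ)) * (12 * ((2 ^ D * ρ : ℕ) : ℝ)) ^ d < (p : ℝ) ^ d)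
    (hN0 : 1 ≤ N0)
    (hK : 4 * (H : ℝ) ^ 2 * √d / (d * ρ ^ 2) + 2 ≤ N0)
    (A' : Finset ℕ) (hA' : A' ⊆ Finset.Icc 1 N0) (hfree : ¬ HasProgression A' k (2 * D)) :
    ∃ A : Finset ℕ, A ⊆ Finset.Icc 1 N ∧ ¬ HasProgression A k D ∧
      (N : ℝ) * (3 / 4 * (H : ℝ) ^ d * A'.card) ≤
        A.card * (p : ℝ) ^ d * ((1 + 2 ^ (2 * D)) * N0) := by
  obtain ⟨θ, hθ⟩ := exists_theta p d (2 ^ D * ρ) (2 ^ D * N)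
    (Nat.one_le_iff_ne_zero.2 (by positivity)) hNp hθ
  obtain ⟨c, hc⟩ := window H d hH hd
  set X := Finset.univ.filter (fun x : Fin d → Fin H =>
      |((∑ i, ((x i : ℕ) : ℤ) ^ 2 : ℤ) : ℝ) - c| ≤ 2 * H ^ 2 * √d) with hX
  have hρ' : (1 : ℝ) ≤ ρ := by exact_mod_cast hρ
  have hd' : (1 : ℝ) ≤ d := by exact_mod_cast hd
  set w : ℤ := d * (ρ : ℤ) ^ 2 with hw
  have hw1 : 1 ≤ w := by
    have : 0 < w := by positivity
    omega
  have hwR : (w : ℝ) = d * ρ ^ 2 := by rw [hw]; push_cast; ring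
  have hwpos : (0 : ℝ) < w := by rw [hwR]; positivity
  let u : (Fin d → Fin H) → ℤ := fun x => (∑ i, ((x i : ℕ) : ℤ) ^ 2) / w
  have hufl : ∀ x, u x = ⌊((∑ i, ((x i : ℕ) : ℤ) ^ 2 : ℤ) : ℝ) / (w : ℝ)⌋ := by
    intro x
    symm
    rw [Int.floor_eq_iff]
    have e1 := Int.mul_ediv_add_emod (∑ i, ((x i : ℕ) : ℤ) ^ 2) w
    have e2 := Int.emod_nonneg (∑ i, ((x i : ℕ) : ℤ) ^ 2) (by omega : w ≠ 0)
    have e3 := Int.emod_lt_of_pos (∑ i, ((x i : ℕ) : ℤ) ^ 2) (by omega : 0 < w)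
    rw [le_div_iff₀ hwpos, div_lt_iff₀ hwpos]
    constructor
    · have : u x * w ≤ ∑ i, ((x i : ℕ) : ℤ) ^ 2 := by simp only [u]; linarith
      exact_mod_cast this
    · have : ∑ i, ((x i : ℕ) : ℤ) ^ 2 < (u x + 1) * w := by simp only [u]; linarith
      exact_mod_cast this
  obtain ⟨t, ht⟩ := exists_shift X u ⌊(c - 2 * H ^ 2 * √d) / w⌋ N0 (2 ^ (2 * D)) N0 hN0
    Nat.one_le_two_pow (fun x hx => by
      have h1 := abs_le.1 (Finset.mem_filter.1 hx).2
      rw [hufl]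
      constructor
      · apply Int.floor_le_floor
        apply div_le_div_of_nonneg_right _ hwpos.le
        linarith
      · have h2 := Int.floor_le (((∑ i, ((x i : ℕ) : ℤ) ^ 2 : ℤ) : ℝ) / (w : ℝ))
        have h3 := Int.lt_floor_add_one ((c - 2 * H ^ 2 * √d) / w)
        have h4 : ((∑ i, ((x i : ℕ) : ℤ) ^ 2 : ℤ) : ℝ) / (w : ℝ) ≤
            (c - 2 * H ^ 2 * √d) / w + 4 * (H : ℝ) ^ 2 * √d / w := by
          rw [← add_div]
          apply div_le_div_of_nonneg_right _ hwpos.le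
          linarith
        rw [← hwR] at hK
        have : ((⌊((∑ i, ((x i : ℕ) : ℤ) ^ 2 : ℤ) : ℝ) / (w : ℝ)⌋ : ℤ) : ℝ) <
          ((⌊(c - 2 * H ^ 2 * √d) / w⌋ : ℤ) : ℝ) + (N0 : ℝ) := by linarith
        exact_mod_cast this) A' hA'
  set S := X.filter (fun x => ∃ a ∈ A', u x = (2 ^ (2 * D) : ℕ) * (a : ℤ) + t) with hS
  have hHp' : H ≤ p := by
    have : H - 1 ≤ 2 ^ D * (H - 1) := Nat.le_mul_of_pos_left _ (by positivity)
    omega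
  obtain ⟨α, hα⟩ := exists_alpha p d N H hHp' θ S
  set A := (Finset.Icc 1 N).filter (fun m : ℕ => ∃ x ∈ S, ∀ i,
        (((x i : Fin H) : ℕ) : ZMod p) = α i + θ i * (m : ZMod p)) with hA
  refine ⟨A, Finset.filter_subset _ _, ?_, ?_⟩
  · rintro ⟨Q, hQ0, hQD, hQ⟩
    have hQ' : ∀ j : ℕ, ∃ m : ℕ, ∃ x : Fin d → Fin H, ∃ a : ℕ, 1 ≤ j → j ≤ k →
        ((m : ℝ) = Q.eval (j : ℝ) ∧ m ∈ Finset.Icc 1 N ∧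
        (∀ i, (((x i : Fin H) : ℕ) : ZMod p) = α i + θ i * (m : ZMod p)) ∧
        a ∈ A' ∧ u x = (2 ^ (2 * D) : ℕ) * (a : ℤ) + t) := by
      intro j
      by_cases hj : 1 ≤ j ∧ j ≤ k
      · obtain ⟨m, hm, hme⟩ := hQ j (Finset.mem_Icc.2 hj)
        obtain ⟨hm1, x, hx, hxm⟩ := Finset.mem_filter.1 hm
        obtain ⟨_, a, ha, hxa⟩ := Finset.mem_filter.1 hx
        exact ⟨m, x, a, fun _ _ => ⟨hme, hm1, hxm, ha, hxa⟩⟩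
      · exact ⟨0, fun _ => ⟨0, hH⟩, 0, fun h1 h2 => absurd ⟨h1, h2⟩ hj⟩
    choose m x a hall using hQ'
    have hdm : ∀ n y, 1 ≤ y → y + n ≤ k →
        ((dd n (fun j => (m j : ℤ)) y : ℤ) : ℝ) = dd n (fun j => Q.eval (j : ℝ)) y := by
      intro n y h1 h2
      rw [← dd_congr n (fun j => (((m j : ℕ) : ℤ) : ℝ)) (fun j => Q.eval (j : ℝ)) y
        (fun j h3 h4 => by
          rw [← (hall j (by omega) (by omega)).1]; push_cast; rfl)]
      exact (dd_map (Int.castAddHom ℝ) n (fun j => (m j : ℤ)) y).symm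
    obtain ⟨y, hy1, hy2⟩ := core p D Q.natDegree k d H w (2 ^ (2 * D) : ℕ) t
      (fun j => (m j : ℤ)) (fun j => (a j : ℤ)) (fun j i => ((x j i : ℕ) : ℤ)) α θ hQ0 hQD hk
      (by exact_mod_cast hH) hw1
      (fun y h1 h2 => by
        have := hdm (Q.natDegree + 1) y h1 h2
        rw [dd_poly_zero Q _ _ (by omega)] at this
        exact_mod_cast this)
      (fun j h1 h2 i => ⟨by positivity, by have := (x j i).2; omega, by
        have := (hall j h1 h2).2.2.1 i
        push_cast; exact this⟩)
      (by zify [hH] at hHp; exact hHp) (by push_cast; exact le_rfl)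
      (fun j h1 h2 => (hall j h1 h2).2.2.2.2)
      (fun P hP1 hP2 => by
        by_contra hP0
        refine hfree ⟨P, Nat.pos_of_ne_zero hP0, hP1, fun j hj => ?_⟩
        rw [Finset.mem_Icc] at hj
        exact ⟨a j, (hall j hj.1 hj.2).2.2.2.1, by
          have := hP2 j hj.1 hj.2
          push_cast at this; exact this⟩)
    refine hθ (dd Q.natDegree (fun j => (m j : ℤ)) 1) ?_ ?_ y ?_ hy2
    · intro h0
      have := hdm Q.natDegree 1 le_rfl (by omega)
      rw [h0, dd_poly_top Q _ _ le_rfl, Int.cast_zero] at this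
      have h1 : Q.coeff Q.natDegree ≠ 0 := by
        rw [Polynomial.coeff_natDegree]
        exact Polynomial.leadingCoeff_ne_zero.2 (fun h => by rw [h] at hQ0; simp at hQ0)
      exact mul_ne_zero h1 (by positivity) this.symm
    · obtain ⟨q, hq⟩ : ∃ q, Q.natDegree = q + 1 := ⟨Q.natDegree - 1, by omega⟩
      rw [hq]
      refine (dd_bound q _ 1 N (fun j h1 h2 => ?_)).trans ?_
      · have := Finset.mem_Icc.1 (hall j h1 (by omega)).2.1
        exact ⟨by positivity, by exact_mod_cast this.2⟩
      · push_cast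
        exact mul_le_mul_of_nonneg_right (pow_le_pow_right₀ (by norm_num) (by omega))
          (by positivity)
    · refine hy1.trans (le_of_eq ?_)
      rw [hw]; push_cast; ring
  · have hα' : (N : ℝ) * S.card ≤ A.card * (p : ℝ) ^ d := by exact_mod_cast hα
    have ht' : (A'.card : ℝ) * X.card ≤ (N0 + 2 ^ (2 * D) * N0) * S.card := by exact_mod_cast ht
    calc (N : ℝ) * (3 / 4 * (H : ℝ) ^ d * A'.card)
        ≤ N * (X.card * A'.card) := by gcongr
      _ ≤ N * ((N0 + 2 ^ (2 * D) * N0) * S.card) := by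
          rw [mul_comm (X.card : ℝ)]; gcongr
      _ = (N * S.card) * (N0 + 2 ^ (2 * D) * N0) := by ring
      _ ≤ (A.card * (p : ℝ) ^ d) * (N0 + 2 ^ (2 * D) * N0) := by gcongr
      _ = _ := by ring

theorem step_real (k D d N N0 : ℕ) (hd : 1 ≤ d) (hk : 2 * D < k) (hN : 1 ≤ N)
    (hN0 : 9216 * 4 ^ (D + 2) * (N : ℝ) ^ ((2 : ℝ) / d) / √d + 2 ≤ N0) :
    (3 / 4 / (1 + 2 ^ (2 * D))) * ((2 : ℝ) ^ (D * d))⁻¹ * ((rkD k (2 * D) N0 : ℝ) / N0) ≤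
      (rkD k D N : ℝ) / N := by
  have hd' : (1 : ℝ) ≤ d := by exact_mod_cast hd
  have hN' : (1 : ℝ) ≤ N := by exact_mod_cast hN
  have h2D : (1 : ℝ) ≤ 2 ^ D := one_le_pow₀ (by norm_num)
  set ν : ℝ := ((2 : ℝ) ^ (D + 2) * N) ^ ((1 : ℝ) / d) with hν
  have hbase : (1 : ℝ) ≤ (2 : ℝ) ^ (D + 2) * N := by
    have : (1 : ℝ) ≤ 2 ^ (D + 2) := one_le_pow₀ (by norm_num)
    nlinarith
  have hν1 : 1 ≤ ν := Real.one_le_rpow hbase (by positivity)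
  have hνd : ν ^ d = (2 : ℝ) ^ (D + 2) * N := by
    rw [hν, ← Real.rpow_natCast, ← Real.rpow_mul (by positivity)]
    rw [one_div_mul_cancel (by positivity), Real.rpow_one]
  have hν2 : ν ^ 2 ≤ 4 ^ (D + 2) * (N : ℝ) ^ ((2 : ℝ) / d) := by
    rw [hν, ← Real.rpow_natCast, ← Real.rpow_mul (by positivity),
      Real.mul_rpow (by positivity) (by positivity)]
    rw [show (1 : ℝ) / d * ((2 : ℕ) : ℝ) = 2 / d by push_cast; ring]
    refine mul_le_mul_of_nonneg_right ?_ (by positivity)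
    rw [show (4 : ℝ) ^ (D + 2) = (2 ^ (D + 2)) ^ (2 : ℝ) by
      rw [show (4 : ℝ) = 2 ^ 2 by norm_num, ← pow_mul, mul_comm, pow_mul]
      norm_cast]
    refine Real.rpow_le_rpow_of_exponent_le (one_le_pow₀ (by norm_num)) ?_
    rw [div_le_iff₀ (by positivity)]; linarith
  obtain ⟨p, hp1, hp2⟩ := Nat.exists_infinite_primes (⌈12 * 2 ^ D * ν⌉₊ + 2 ^ D * N + 2 ^ D + 1)
  have hq2 : 0 < 2 ^ D := by positivity
  have : Fact p.Prime := ⟨hp2⟩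
  have hpa : 12 * 2 ^ D * ν ≤ p := by
    refine (Nat.le_ceil _).trans ?_
    exact_mod_cast (by omega : ⌈12 * 2 ^ D * ν⌉₊ ≤ p)
  have hpb : 2 ^ D * N < p := by omega
  have hpc : (2 : ℝ) ^ D ≤ p := by
    exact_mod_cast (by omega : 2 ^ D ≤ p)
  have hp0 : (0 : ℝ) < p := by linarith
  set z : ℝ := p / (12 * 2 ^ D * ν) with hz
  have hz1 : 1 ≤ z := by rw [hz, one_le_div (by positivity)]; exact hpa
  set ρ := ⌊z⌋₊ with hρ
  have hρ1 : 1 ≤ ρ := Nat.le_floor (by exact_mod_cast hz1)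
  have hρz : (ρ : ℝ) ≤ z := Nat.floor_le (by linarith)
  have hρz2 : z / 2 ≤ ρ := by
    have h1 := Nat.lt_floor_add_one z
    have h2 : (1 : ℝ) ≤ ρ := by exact_mod_cast hρ1
    linarith
  set H := ⌈(p : ℝ) / 2 ^ D⌉₊ with hH
  have hHl : (p : ℝ) / 2 ^ D ≤ H := Nat.le_ceil _
  have hHu : (H : ℝ) < p / 2 ^ D + 1 := Nat.ceil_lt_add_one (by positivity)
  have hH1 : 1 ≤ H := Nat.one_le_iff_ne_zero.2 (Nat.ceil_pos.2 (by positivity)).ne'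
  have hp1' : 1 ≤ (p : ℝ) / 2 ^ D := by rw [one_le_div (by positivity)]; exact hpc
  have hHp : 2 ^ D * (H - 1) < p := by
    have h1 : ((H - 1 : ℕ) : ℝ) < p / 2 ^ D := by
      rw [Nat.cast_sub hH1]; push_cast; linarith
    rw [lt_div_iff₀ (by positivity)] at h1
    rw [mul_comm]
    exact_mod_cast h1
  obtain ⟨A', hA'1, hA'2, hA'3⟩ := rkD_attained k (2 * D) N0 (by omega)
  have hN0' : (2 : ℝ) ≤ N0 := by
    have : 0 ≤ 9216 * 4 ^ (D + 2) * (N : ℝ) ^ ((2 : ℝ) / d) / √d := by positivity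
    linarith
  have hN01 : 1 ≤ N0 := by
    have : 2 ≤ N0 := by exact_mod_cast hN0'
    omega
  obtain ⟨A, hA1, hA2, hA3⟩ := step_nat p k D d N N0 H ρ hd hk hρ1 hH1 hHp hpb (by
      push_cast
      have h1 : 12 * (2 ^ D * (ρ : ℝ)) ≤ p / ν := by
        calc 12 * (2 ^ D * (ρ : ℝ)) ≤ 12 * (2 ^ D * z) := by gcongr
          _ = p / ν := by rw [hz]; field_simp
      calc 2 * (2 ^ D * (N : ℝ)) * (12 * (2 ^ D * (ρ : ℝ))) ^ d
          ≤ 2 * (2 ^ D * (N : ℝ)) * (p / ν) ^ d := by gcongr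
        _ = (p : ℝ) ^ d / 2 := by
            rw [div_pow, hνd, pow_add]; field_simp
        _ < (p : ℝ) ^ d := by
            have : 0 < (p : ℝ) ^ d := by positivity
            linarith) hN01 (by
      refine le_trans ?_ hN0
      have hs : 0 < √(d : ℝ) := Real.sqrt_pos.2 (by positivity)
      have hss : √(d : ℝ) * √(d : ℝ) = d := Real.mul_self_sqrt (by positivity)
      have e1 : (H : ℝ) ≤ 2 * (p / 2 ^ D) := by linarith
      have e2 : 4 * (H : ℝ) ^ 2 * √d / (d * ρ ^ 2) ≤
          4 * (2 * (p / 2 ^ D)) ^ 2 * √d / (d * (z / 2) ^ 2) := by gcongr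
      have e3 : 4 * (2 * (p / 2 ^ D)) ^ 2 * √d / (d * (z / 2) ^ 2) = 9216 * ν ^ 2 / √d := by
        rw [hz]
        field_simp
        rw [sq (√(d : ℝ)), hss]; ring
      have e4 : 9216 * ν ^ 2 / √d ≤ 9216 * (4 ^ (D + 2) * (N : ℝ) ^ ((2 : ℝ) / d)) / √d := by
        gcongr
      rw [← mul_assoc] at e4
      linarith) A' hA'1 hA'2
  have hA4 := le_rkD k D N A hA1 hA2
  rw [hA'3] at hA3
  have hHd : (p : ℝ) ^ d / 2 ^ (D * d) ≤ (H : ℝ) ^ d := by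
    rw [pow_mul, ← div_pow]; gcongr
  have hA4' : (A.card : ℝ) ≤ rkD k D N := by exact_mod_cast hA4
  refine le_trans ?_ (div_le_div_of_nonneg_right hA4' (by positivity))
  rw [le_div_iff₀ (by positivity)]
  have hpd : 0 < (p : ℝ) ^ d := by positivity
  have f1 : (N : ℝ) * (3 / 4 * ((p : ℝ) ^ d / 2 ^ (D * d)) * rkD k (2 * D) N0) ≤
      A.card * (p : ℝ) ^ d * ((1 + 2 ^ (2 * D)) * N0) := by
    refine le_trans ?_ hA3
    gcongr
  have hpos : 0 < (p : ℝ) ^ d * ((1 + 2 ^ (2 * D)) * N0) := by positivity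
  refine le_of_mul_le_mul_right ?_ hpos
  calc _ = (N : ℝ) * (3 / 4 * ((p : ℝ) ^ d / 2 ^ (D * d)) * rkD k (2 * D) N0) := by
        field_simp
    _ ≤ _ := f1
    _ = _ := by ring

theorem ident (n D L : ℝ) (hn : 0 < n) (hD : 0 < D) (hL : 0 < L) (d0 : ℝ)
    (hd0 : d0 = 2 ^ (n / 2) * (L / D) ^ (1 / (n + 1))) :
    D * d0 + n * 2 ^ ((n - 1) / 2) * (2 * D) ^ ((n - 1) / n) * (2 * L / d0) ^ (1 / n) =
      (n + 1) * 2 ^ (n / 2) * D ^ (n / (n + 1)) * L ^ (1 / (n + 1)) := by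
  obtain ⟨δ, rfl⟩ : ∃ δ : ℝ, D = 2 ^ δ :=
    ⟨Real.logb 2 D, (Real.rpow_logb (by norm_num) (by norm_num) hD).symm⟩
  obtain ⟨l, rfl⟩ : ∃ l : ℝ, L = 2 ^ l :=
    ⟨Real.logb 2 L, (Real.rpow_logb (by norm_num) (by norm_num) hL).symm⟩
  have two : (0 : ℝ) < 2 := by norm_num
  have m1 : ∀ a b : ℝ, (2 : ℝ) * 2 ^ a = 2 ^ (1 + a) := fun a b => by
    rw [Real.rpow_add two, Real.rpow_one]
  have e0 : d0 = 2 ^ (n / 2 + (l - δ) * (1 / (n + 1))) := by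
    rw [hd0, ← Real.rpow_sub two, ← Real.rpow_mul two.le, ← Real.rpow_add two]
  have e1 : (2 : ℝ) ^ δ * d0 = 2 ^ (n / 2) * (2 ^ δ) ^ (n / (n + 1)) * (2 ^ l) ^ (1 / (n + 1)) := by
    rw [e0, ← Real.rpow_mul two.le, ← Real.rpow_mul two.le, ← Real.rpow_add two,
      ← Real.rpow_add two, ← Real.rpow_add two]
    congr 1
    field_simp
    ring
  have e2 : (2 : ℝ) ^ ((n - 1) / 2) * (2 * 2 ^ δ) ^ ((n - 1) / n) * (2 * 2 ^ l / d0) ^ (1 / n) =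
      2 ^ (n / 2) * (2 ^ δ) ^ (n / (n + 1)) * (2 ^ l) ^ (1 / (n + 1)) := by
    rw [e0, m1 δ 0, m1 l 0, ← Real.rpow_sub two]
    simp only [← Real.rpow_mul two.le, ← Real.rpow_add two]
    congr 1
    field_simp
    ring
  rw [e1, mul_assoc n, mul_assoc n, e2]
  ring

/-- the target bound -/
def Claim (ν : ℝ) (k D : ℕ) : Prop :=
  ∃ C : ℝ, 0 < C ∧ ∀ N : ℕ, 1 ≤ N →
      (rkD k D N : ℝ) / N ≥
        C * (Real.logb 2 N) ^ ((1 : ℝ) / (2 * ν)) /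
          (2 : ℝ) ^ (ν * (2 : ℝ) ^ ((ν - 1) / 2) *
            (D : ℝ) ^ ((ν - 1) / ν) *
            (Real.logb 2 N) ^ ((1 : ℝ) / ν))

/-- properties of the dimension -/
theorem dim_props (n D L : ℝ) (hn : 1 ≤ n) (hD : 1 ≤ D) (hL : 1 ≤ L) (d0 : ℝ)
    (hd0 : d0 = 2 ^ (n / 2) * (L / D) ^ (1 / (n + 1))) :
    0 < d0 ∧ 1 ≤ ⌈d0⌉₊ ∧ d0 ≤ ⌈d0⌉₊ ∧ (⌈d0⌉₊ : ℝ) ≤ d0 + 1 ∧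
      (⌈d0⌉₊ : ℝ) ≤ (2 ^ (n / 2) + 1) * L ^ (1 / (n + 1)) := by
  have h0 : 0 < d0 := by rw [hd0]; positivity
  have h1 : (⌈d0⌉₊ : ℝ) ≤ d0 + 1 := (Nat.ceil_lt_add_one h0.le).le
  refine ⟨h0, Nat.ceil_pos.2 h0, Nat.le_ceil _, h1, h1.trans ?_⟩
  have h2 : (L / D) ^ (1 / (n + 1)) ≤ L ^ (1 / (n + 1)) := by
    apply Real.rpow_le_rpow (by positivity) (div_le_self (by positivity) hD) (by positivity)
  have h3 : 1 ≤ L ^ (1 / (n + 1)) := Real.one_le_rpow hL (by positivity)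
  rw [hd0, add_mul, one_mul]
  gcongr

theorem two_pow_Dd (D : ℕ) (d0 : ℝ) (hd : (⌈d0⌉₊ : ℝ) ≤ d0 + 1) :
    ((2 : ℝ) ^ D)⁻¹ * ((2 : ℝ) ^ ((D : ℝ) * d0))⁻¹ ≤ ((2 : ℝ) ^ (D * ⌈d0⌉₊))⁻¹ := by
  rw [← mul_inv]
  apply inv_anti₀ (by positivity)
  rw [← Real.rpow_natCast 2 D, ← Real.rpow_natCast, ← Real.rpow_add (by norm_num)]
  apply Real.rpow_le_rpow_of_exponent_le (by norm_num)
  push_cast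
  have : (D : ℝ) * ⌈d0⌉₊ ≤ D * (d0 + 1) := by gcongr
  linarith

theorem N_rpow (N : ℕ) (hN : 1 ≤ N) (d : ℝ) :
    (N : ℝ) ^ (2 / d) = 2 ^ (2 * Real.logb 2 N / d) := by
  have hN' : (0 : ℝ) < N := by exact_mod_cast hN
  conv_lhs => rw [← Real.rpow_logb (by norm_num : (0:ℝ) < 2) (by norm_num) hN']
  rw [← Real.rpow_mul (by norm_num)]
  congr 1
  ring

theorem claim_of_ge_two (ν : ℝ) (hν : 0 < ν) (k D : ℕ)
    (h : ∃ C : ℝ, 0 < C ∧ ∀ N : ℕ, 1 ≤ N → 1 ≤ Real.logb 2 N →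
      C * (Real.logb 2 N) ^ ((1 : ℝ) / (2 * ν)) *
          ((2 : ℝ) ^ (ν * (2 : ℝ) ^ ((ν - 1) / 2) * (D : ℝ) ^ ((ν - 1) / ν) *
            (Real.logb 2 N) ^ ((1 : ℝ) / ν)))⁻¹ ≤ (rkD k D N : ℝ) / N) : Claim ν k D := by
  obtain ⟨C, hC, h⟩ := h
  refine ⟨C, hC, fun N hN => ?_⟩
  rcases hN.eq_or_lt with rfl | h2
  · rw [Nat.cast_one, Real.logb_one, Real.zero_rpow (by positivity)]
    simp
  · rw [ge_iff_le, div_eq_mul_inv (C * _)]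
    refine h N hN ?_
    rw [Real.le_logb_iff_rpow_le (by norm_num) (by positivity), Real.rpow_one]
    exact_mod_cast h2

theorem claim_base (k D : ℕ) (hD : 1 ≤ D) (hk : 2 * D < k) : Claim 2 k D := by
  apply claim_of_ge_two 2 (by norm_num)
  have hD' : (1 : ℝ) ≤ D := by exact_mod_cast hD
  set κ : ℝ := 2 ^ ((1 : ℝ) / 2) + 1 with hκ
  have hκ0 : 0 < κ := by positivity
  set C1 : ℝ := 9216 * 4 ^ (D + 2) with hC1
  have hC10 : 0 < C1 := by positivity
  set q : ℝ := 3 / 4 / (1 + 2 ^ (2 * D)) with hq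
  have hq0 : 0 < q := by positivity
  set g : ℝ := (2 ^ ((1 : ℝ) / 2) * (1 / D) ^ ((1 : ℝ) / 2)) ^ ((1 : ℝ) / 2) with hg
  have hg0 : 0 < g := by positivity
  refine ⟨q * (2 ^ D)⁻¹ * g * (C1 + 3 * κ ^ 2)⁻¹, by positivity, fun N hN hL => ?_⟩
  set L := Real.logb 2 N with hLdef
  set d0 : ℝ := 2 ^ ((1 : ℝ) / 2) * (L / D) ^ ((1 : ℝ) / (1 + 1)) with hd0
  obtain ⟨p0, p1, p2, p3, p4⟩ := dim_props 1 D L le_rfl hD' hL d0 hd0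
  have hid := ident 1 D L one_pos (by positivity) (by positivity) d0 hd0
  have hdd := two_pow_Dd D d0 p3
  set d := ⌈d0⌉₊ with hd
  have p1' : (1 : ℝ) ≤ d := by exact_mod_cast p1
  set E : ℝ := 2 * L / d with hE
  have hE0 : 0 < E := by positivity
  have hNE : (N : ℝ) ^ ((2 : ℝ) / d) = 2 ^ E := N_rpow N hN d
  have hs : 0 < √(d : ℝ) := Real.sqrt_pos.2 (by positivity)
  -- E is at least a constant times d
  have hdE : (d : ℝ) ≤ κ ^ 2 * 2 ^ E := by
    have h1 : (d : ℝ) ^ 2 ≤ κ ^ 2 * L := by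
      calc (d : ℝ) ^ 2 ≤ (κ * L ^ ((1 : ℝ) / (1 + 1))) ^ 2 := by gcongr
        _ = κ ^ 2 * L := by
          rw [mul_pow, ← Real.rpow_natCast (L ^ _), ← Real.rpow_mul (by positivity)]
          norm_num
    have h2 : (d : ℝ) * 2 ≤ κ ^ 2 * E := by
      rw [hE, mul_div_assoc', le_div_iff₀ (by positivity)]
      nlinarith
    have h3 : E ≤ 2 * 2 ^ E := by
      have h4 := Real.add_one_le_exp (Real.log 2 * E)
      rw [Real.rpow_def_of_pos (by norm_num)]
      have h5 := Real.log_two_gt_d9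
      nlinarith
    have h6 : κ ^ 2 * E ≤ κ ^ 2 * (2 * 2 ^ E) := by gcongr
    linarith
  have hsE : √(d : ℝ) ≤ κ ^ 2 * 2 ^ E := by
    refine le_trans ?_ hdE
    rw [Real.sqrt_le_left (by positivity)]
    nlinarith
  set N0 := ⌈C1 * 2 ^ E / √d⌉₊ + 2 with hN0
  have hst := step_real k D d N N0 p1 hk hN (by
    rw [hNE, hN0]; push_cast
    have := Nat.le_ceil (C1 * 2 ^ E / √d)
    linarith)
  have hN0u : (N0 : ℝ) ≤ (C1 + 3 * κ ^ 2) * (2 ^ E / √d) := by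
    have h1 := Nat.ceil_lt_add_one (a := C1 * 2 ^ E / √d) (by positivity)
    have h2 : 1 ≤ κ ^ 2 * (2 ^ E / √d) := by
      rw [mul_div_assoc', one_le_div hs]; exact hsE
    rw [hN0]; push_cast
    have h3 : (C1 + 3 * κ ^ 2) * (2 ^ E / √d) = C1 * 2 ^ E / √d + 3 * (κ ^ 2 * (2 ^ E / √d)) := by
      ring
    linarith
  have hN0p : (0 : ℝ) < N0 := by rw [hN0]; positivity
  have hr : (1 : ℝ) ≤ rkD k (2 * D) N0 := by
    exact_mod_cast one_le_rkD k (2 * D) N0 hk (by omega)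
  have hEE : (2 : ℝ) ^ E ≤ 2 ^ (2 * L / d0) := by
    apply Real.rpow_le_rpow_of_exponent_le (by norm_num)
    rw [hE]; gcongr
  have hsd : g * L ^ ((1 : ℝ) / (2 * 2)) ≤ √d := by
    calc g * L ^ ((1 : ℝ) / (2 * 2)) = √d0 := by
          rw [Real.sqrt_eq_rpow, hd0, hg]
          rw [show L / D = 1 / D * L by ring,
            Real.mul_rpow (x := 1 / (D : ℝ)) (y := L) (by positivity) (by positivity), ← mul_assoc]
          rw [Real.mul_rpow (y := L ^ ((1 : ℝ) / (1 + 1))) (by positivity) (by positivity),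
            ← Real.rpow_mul (x := L) (by positivity)]
          norm_num
      _ ≤ √d := Real.sqrt_le_sqrt p2
  have hN0i : (C1 + 3 * κ ^ 2)⁻¹ * ((g * L ^ ((1 : ℝ) / (2 * 2))) * (2 ^ (2 * L / d0))⁻¹) ≤
      (rkD k (2 * D) N0 : ℝ) / N0 := by
    calc _ ≤ (C1 + 3 * κ ^ 2)⁻¹ * (√d * (2 ^ E)⁻¹) := by gcongr
      _ = ((C1 + 3 * κ ^ 2) * (2 ^ E / √d))⁻¹ := by field_simp
      _ ≤ (N0 : ℝ)⁻¹ := by gcongr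
      _ ≤ _ := by rw [inv_eq_one_div]; gcongr
  have hid' : (2 : ℝ) ^ ((2 : ℝ) * 2 ^ (((2 : ℝ) - 1) / 2) * (D : ℝ) ^ (((2 : ℝ) - 1) / 2) *
      L ^ ((1 : ℝ) / 2)) = 2 ^ ((D : ℝ) * d0) * 2 ^ (2 * L / d0) := by
    rw [← Real.rpow_add (by norm_num)]
    congr 1
    norm_num at hid ⊢
    linarith
  rw [hid', mul_inv]
  refine le_trans (le_of_eq ?_) (le_trans (mul_le_mul
    (mul_le_mul_of_nonneg_left hdd hq0.le) hN0i (by positivity) (by positivity)) hst)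
  ring

theorem claim_succ (n k D : ℕ) (hn : 2 ≤ n) (hD : 1 ≤ D) (hk : 2 * D < k)
    (hc : Claim n k (2 * D)) : Claim ((n : ℝ) + 1) k D := by
  obtain ⟨C, hC, hc⟩ := hc
  apply claim_of_ge_two _ (by positivity)
  have hD' : (1 : ℝ) ≤ D := by exact_mod_cast hD
  have hn1 : (1 : ℝ) ≤ n := by exact_mod_cast (by omega : 1 ≤ n)
  have hn0 : (0 : ℝ) < n := by linarith
  set κ : ℝ := 2 ^ ((n : ℝ) / 2) + 1 with hκ
  have hκ0 : 0 < κ := by positivity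
  set C1 : ℝ := 9216 * 4 ^ (D + 2) with hC1
  have hC11 : 1 ≤ C1 := by
    have : (1 : ℝ) ≤ 4 ^ (D + 2) := one_le_pow₀ (by norm_num)
    rw [hC1]; linarith
  set q : ℝ := 3 / 4 / (1 + 2 ^ (2 * D)) with hq
  have hq0 : 0 < q := by positivity
  set c0 : ℝ := Real.logb 2 (C1 + 3) with hc0
  have hc00 : 0 ≤ c0 := Real.logb_nonneg (by norm_num) (by linarith)
  set K : ℝ := n * 2 ^ (((n : ℝ) - 1) / 2) * (2 * D) ^ (((n : ℝ) - 1) / n) with hK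
  have hK0 : 0 < K := by positivity
  refine ⟨q * (2 ^ D)⁻¹ * C * (2 / κ) ^ ((1 : ℝ) / (2 * n)) * (2 ^ (K * c0 ^ ((1 : ℝ) / n)))⁻¹,
    by positivity, fun N hN hL => ?_⟩
  set L := Real.logb 2 N with hLdef
  set d0 : ℝ := 2 ^ ((n : ℝ) / 2) * (L / D) ^ ((1 : ℝ) / (n + 1)) with hd0
  obtain ⟨p0, p1, p2, p3, p4⟩ := dim_props n D L hn1 hD' hL d0 hd0
  have hid := ident n D L hn0 (by positivity) (by positivity) d0 hd0
  rw [← hK] at hid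
  have hdd := two_pow_Dd D d0 p3
  set d := ⌈d0⌉₊ with hd
  have p1' : (1 : ℝ) ≤ d := by exact_mod_cast p1
  set E : ℝ := 2 * L / d with hE
  have hE0 : 0 < E := by positivity
  have hNE : (N : ℝ) ^ ((2 : ℝ) / d) = 2 ^ E := N_rpow N hN d
  have hs : 1 ≤ √(d : ℝ) := Real.one_le_sqrt.2 p1'
  set N0 := ⌈C1 * 2 ^ E⌉₊ + 2 with hN0
  have hceil := Nat.le_ceil (C1 * 2 ^ E)
  have hst := step_real k D d N N0 p1 hk hN (by
    rw [hNE, hN0]; push_cast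
    have : C1 * 2 ^ E / √d ≤ C1 * 2 ^ E := div_le_self (by positivity) hs
    linarith)
  have h2E : 1 ≤ (2 : ℝ) ^ E := Real.one_le_rpow (by norm_num) hE0.le
  have hN0p : (0 : ℝ) < N0 := by rw [hN0]; positivity
  have hN0l : (2 : ℝ) ^ E ≤ N0 := by
    rw [hN0]; push_cast
    nlinarith
  have hN0u : (N0 : ℝ) ≤ (C1 + 3) * 2 ^ E := by
    have h1 := Nat.ceil_lt_add_one (a := C1 * 2 ^ E) (by positivity)
    rw [hN0]; push_cast
    nlinarith
  have hc' := hc N0 (by omega)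
  set L0 := Real.logb 2 N0 with hL0
  have hL0l : E ≤ L0 := by
    rw [hL0, Real.le_logb_iff_rpow_le (by norm_num) hN0p]; exact hN0l
  have hL0u : L0 ≤ E + c0 := by
    rw [hL0, Real.logb_le_iff_le_rpow (by norm_num) hN0p, Real.rpow_add (by norm_num), hc0,
      Real.rpow_logb (by norm_num) (by norm_num) (by linarith), mul_comm]
    exact hN0u
  have hL0n : L0 ^ ((1 : ℝ) / n) ≤ (2 * L / d0) ^ ((1 : ℝ) / n) + c0 ^ ((1 : ℝ) / n) := by
    calc L0 ^ ((1 : ℝ) / n) ≤ (E + c0) ^ ((1 : ℝ) / n) := by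
          apply Real.rpow_le_rpow (by linarith) hL0u (by positivity)
      _ ≤ E ^ ((1 : ℝ) / n) + c0 ^ ((1 : ℝ) / n) := by
          apply Real.rpow_add_le_add_rpow hE0.le hc00 (by positivity)
          rw [div_le_one hn0]; exact hn1
      _ ≤ _ := by
          rw [hE]; gcongr
  have hEl : (2 / κ) * L ^ ((n : ℝ) / (n + 1)) ≤ E := by
    rw [hE, le_div_iff₀ (by positivity)]
    calc (2 / κ) * L ^ ((n : ℝ) / (n + 1)) * d
        ≤ (2 / κ) * L ^ ((n : ℝ) / (n + 1)) * (κ * L ^ ((1 : ℝ) / (n + 1))) := by gcongr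
      _ = 2 * (L ^ ((n : ℝ) / (n + 1)) * L ^ ((1 : ℝ) / (n + 1))) := by field_simp
      _ = 2 * L := by
          rw [← Real.rpow_add (by positivity), ← add_div, div_self (by positivity), Real.rpow_one]
  have hEl2 : (2 / κ) ^ ((1 : ℝ) / (2 * n)) * L ^ ((1 : ℝ) / (2 * (n + 1))) ≤
      L0 ^ ((1 : ℝ) / (2 * n)) := by
    calc _ = ((2 / κ) * L ^ ((n : ℝ) / (n + 1))) ^ ((1 : ℝ) / (2 * n)) := by
          rw [Real.mul_rpow (by positivity) (by positivity), ← Real.rpow_mul (by positivity)]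
          congr 2
          field_simp
      _ ≤ _ := Real.rpow_le_rpow (by positivity) (hEl.trans hL0l) (by positivity)
  have hfin : C * ((2 / κ) ^ ((1 : ℝ) / (2 * n)) * L ^ ((1 : ℝ) / (2 * (n + 1)))) *
      ((2 ^ (K * (2 * L / d0) ^ ((1 : ℝ) / n)))⁻¹ * (2 ^ (K * c0 ^ ((1 : ℝ) / n)))⁻¹) ≤
      (rkD k (2 * D) N0 : ℝ) / N0 := by
    refine le_trans ?_ hc'
    rw [div_eq_mul_inv (C * _), ← mul_inv, ← Real.rpow_add (by norm_num), ← mul_add]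
    push_cast
    rw [← hK]
    have h1 : (2 : ℝ) ^ (K * L0 ^ ((1 : ℝ) / n)) ≤
        2 ^ (K * ((2 * L / d0) ^ ((1 : ℝ) / n) + c0 ^ ((1 : ℝ) / n))) := by
      apply Real.rpow_le_rpow_of_exponent_le (by norm_num)
      gcongr
    exact mul_le_mul (mul_le_mul_of_nonneg_left hEl2 hC.le) (inv_anti₀ (by positivity) h1)
      (by positivity) (by have := hE0.le.trans hL0l; positivity)
  have hid' : (2 : ℝ) ^ (((n : ℝ) + 1) * 2 ^ (((n : ℝ) + 1 - 1) / 2) *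
      (D : ℝ) ^ (((n : ℝ) + 1 - 1) / (n + 1)) * L ^ ((1 : ℝ) / (n + 1))) =
      2 ^ ((D : ℝ) * d0) * 2 ^ (K * (2 * L / d0) ^ ((1 : ℝ) / n)) := by
    rw [← Real.rpow_add (by norm_num), hid, add_sub_cancel_right]
  rw [hid', mul_inv]
  refine le_trans (le_of_eq ?_) (le_trans (mul_le_mul
    (mul_le_mul_of_nonneg_left hdd hq0.le) hfin (by positivity) (by positivity)) hst)
  ring

theorem claim_all (n : ℕ) : ∀ k D : ℕ, 1 ≤ D → 2 ^ (n + 1) * D < k → Claim ((n + 2 : ℕ) : ℝ) k D := by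
  induction n with
  | zero =>
    intro k D hD hk
    have := claim_base k D hD (by simpa using hk)
    simpa using this
  | succ n ih =>
    intro k D hD hk
    have h1 := ih k (2 * D) (by omega) (by rw [← mul_assoc, ← pow_succ]; exact hk)
    have h2 : 2 * D < k := by
      refine lt_of_le_of_lt ?_ hk
      exact Nat.mul_le_mul_right D (Nat.le_self_pow (by omega) 2)
    have h3 := claim_succ (n + 2) k D (by omega) hD h2 h1
    have e : ((n + 1 + 2 : ℕ) : ℝ) = ((n + 2 : ℕ) : ℝ) + 1 := by push_cast; ring
    rw [e]; exact h3

theorem stmt2 (k D : ℕ) (hD : 1 ≤ D) (hk : 2 * D < k)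
    (n : ℤ) (hn : n = ⌈Real.logb 2 ((k : ℝ) / (D : ℝ))⌉) :
    ∃ C : ℝ, 0 < C ∧ ∀ N : ℕ, 1 ≤ N →
      (rkD k D N : ℝ) / N ≥
        C * (Real.logb 2 N) ^ ((1 : ℝ) / (2 * (n : ℝ))) /
          (2 : ℝ) ^ ((n : ℝ) * (2 : ℝ) ^ (((n : ℝ) - 1) / 2) *
            (D : ℝ) ^ (((n : ℝ) - 1) / (n : ℝ)) *
            (Real.logb 2 N) ^ ((1 : ℝ) / (n : ℝ))) := by
  have hD0 : (0 : ℝ) < D := by exact_mod_cast hD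
  have hk0 : (0 : ℝ) < k := by exact_mod_cast (by omega : 0 < k)
  have hlog : 1 < Real.logb 2 ((k : ℝ) / D) := by
    rw [Real.lt_logb_iff_rpow_lt (by norm_num) (by positivity), Real.rpow_one, lt_div_iff₀ hD0]
    exact_mod_cast hk
  have hn2 : 1 < n := by
    rw [hn, Int.lt_ceil]; simpa using hlog
  obtain ⟨m, rfl⟩ : ∃ m : ℕ, n = ((m + 2 : ℕ) : ℤ) := ⟨(n - 2).toNat, by omega⟩
  have hlt : ((m + 1 : ℕ) : ℝ) < Real.logb 2 ((k : ℝ) / D) := by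
    have h1 : (((m + 2 : ℕ) : ℤ) : ℝ) < Real.logb 2 ((k : ℝ) / D) + 1 := by
      rw [hn]; exact Int.ceil_lt_add_one _
    push_cast at h1 ⊢
    linarith
  rw [Real.lt_logb_iff_rpow_lt (by norm_num) (by positivity), Real.rpow_natCast,
    lt_div_iff₀ hD0] at hlt
  have := claim_all m k D hD (by exact_mod_cast hlt)
  rw [Int.cast_natCast]
  exact this
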